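/- For every natural number k ≥ 1, the determinant of the k×k integer matrix H_k(C) + H'_k(C) − E_{k−1,k−1}, i.e., the matrix whose (i,j) entry (for 0 ≤ i,j ≤ k−1) is catalan(i+j) + catalan(i+j+1), minus 1 when i = j = k−1, equals fib(2k). -/

import Mathlib

/-- Ballot-type numbers `binom(2n, n+p) - binom(2n, n+p+1)`. -/
def ballotL (n p : ℕ) : ℤ := ((2 * n).choose (n + p) : ℤ) - ((2 * n).choose (n + p + 1) : ℤ)

theorem choose_two_step (m r : ℕ) : ((m + 2).choose (r + 2) : ℤ) =
    (m.choose r : ℤ) + 2 * (m.choose (r + 1) : ℤ) + (m.choose (r + 2) : ℤ) := by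
  rw [Nat.choose_succ_succ' (m + 1) (r + 1), Nat.choose_succ_succ' m r,
    Nat.choose_succ_succ' m (r + 1)]
  push_cast
  ring

theorem ballotL_succ_succ (n p : ℕ) : ballotL (n + 1) (p + 1) =
    ballotL n p + 2 * ballotL n (p + 1) + ballotL n (p + 2) := by
  unfold ballotL
  have h1 := choose_two_step (2 * n) (n + p)
  have h2 := choose_two_step (2 * n) (n + p + 1)
  rw [show 2 * (n + 1) = 2 * n + 2 by ring, show n + 1 + (p + 1) = n + p + 2 by ring,
    show n + p + 2 + 1 = n + p + 1 + 2 by ring, h1, h2]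
  simp only [← add_assoc]
  ring

theorem ballotL_succ_zero (n : ℕ) : ballotL (n + 1) 0 = ballotL n 0 + ballotL n 1 := by
  cases n with
  | zero => decide
  | succ m =>
    unfold ballotL
    have h1 := choose_two_step (2 * (m + 1)) m
    have h2 := choose_two_step (2 * (m + 1)) (m + 1)
    have h3 : (2 * (m + 1)).choose m = (2 * (m + 1)).choose (m + 2) :=
      Nat.choose_symm_of_eq_add (by ring)
    rw [show 2 * (m + 1 + 1) = 2 * (m + 1) + 2 by ring]
    simp only [add_zero, add_assoc] at *
    norm_num at *
    rw [h1, h2, h3]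
    ring

theorem ballotL_eq_zero {n p : ℕ} (h : n < p) : ballotL n p = 0 := by
  unfold ballotL
  rw [Nat.choose_eq_zero_of_lt (by omega), Nat.choose_eq_zero_of_lt (by omega)]
  simp

theorem ballotL_self (n : ℕ) : ballotL n n = 1 := by
  unfold ballotL
  rw [← two_mul, Nat.choose_self, Nat.choose_eq_zero_of_lt (by omega)]
  simp

theorem ballotL_zero_right (n : ℕ) : ballotL n 0 = (catalan n : ℤ) := by
  have h1 := succ_mul_catalan_eq_centralBinom n
  have h2 := Nat.choose_succ_right_eq (2 * n) n
  rw [show 2 * n - n = n by omega] at h2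
  unfold Nat.centralBinom at h1
  unfold ballotL
  have h3 : ((n : ℤ) + 1) ≠ 0 := by positivity
  apply mul_left_cancel₀ h3
  zify at h1 h2
  simp only [add_zero]
  linear_combination -h1 - h2

theorem ballotL_sum_shift (i j k : ℕ) :
    ∑ p ∈ Finset.range (k + 1), ballotL (i + 1) p * ballotL j p =
    ∑ p ∈ Finset.range (k + 1), ballotL i p * ballotL (j + 1) p
      + ballotL i (k + 1) * ballotL j k - ballotL i k * ballotL j (k + 1) := by
  induction k with
  | zero => simp [ballotL_succ_zero]; ring
  | succ k ih =>
    rw [Finset.sum_range_succ, ih, Finset.sum_range_succ _ (k + 1), ballotL_succ_succ,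
      ballotL_succ_succ]
    ring

theorem ballotL_sum (k i : ℕ) : ∀ j, i < k →
    ∑ p ∈ Finset.range k, ballotL i p * ballotL j p = ballotL (i + j) 0 := by
  induction i with
  | zero =>
    intro j hk
    obtain ⟨k, rfl⟩ : ∃ m, k = m + 1 := ⟨k - 1, by omega⟩
    rw [Finset.sum_range_succ', Finset.sum_eq_zero]
    · simp [ballotL_self]
    · intro p _
      rw [ballotL_eq_zero (by omega)]
      simp
  | succ i ih =>
    intro j hk
    obtain ⟨k, rfl⟩ : ∃ m, k = m + 1 := ⟨k - 1, by omega⟩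
    rw [ballotL_sum_shift, ih _ (by omega), ballotL_eq_zero (show i < k by omega),
      ballotL_eq_zero (show i < k + 1 by omega), show i + 1 + j = i + (j + 1) by ring]
    simp

/-- Tridiagonal matrix entries with diagonal `f` and off-diagonal entries one. -/
def triE (f : ℕ → ℤ) (p q : ℕ) : ℤ :=
  (if p = q then f p else 0) + (if p + 1 = q then 1 else 0) + (if p = q + 1 then 1 else 0)

/-- Tridiagonal matrix with diagonal `f` and off-diagonal entries one. -/
def triM (f : ℕ → ℤ) (n : ℕ) : Matrix (Fin n) (Fin n) ℤ := Matrix.of fun i j => triE f i j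

theorem triE_succ (f : ℕ → ℤ) (p q : ℕ) :
    triE f (p + 1) (q + 1) = triE (fun i => f (i + 1)) p q := by
  simp [triE]

theorem triM_det (f : ℕ → ℤ) (n : ℕ) : (triM f (n + 2)).det =
    f 0 * (triM (fun i => f (i + 1)) (n + 1)).det - (triM (fun i => f (i + 2)) n).det := by
  rw [Matrix.det_succ_row_zero, Fin.sum_univ_succ, Fin.sum_univ_succ, Finset.sum_eq_zero]
  · have e1 : (triM f (n + 2)).submatrix Fin.succ (Fin.succAbove 0) =
        triM (fun i => f (i + 1)) (n + 1) := by
      ext i j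
      simp [triM, triE_succ]
    have e2 : ((triM f (n + 2)).submatrix Fin.succ
        (Fin.succAbove (Fin.succ (0 : Fin (n + 1))))).det = (triM (fun i => f (i + 2)) n).det := by
      rw [Matrix.det_succ_column_zero, Fin.sum_univ_succ, Finset.sum_eq_zero]
      · have : (((triM f (n + 2)).submatrix Fin.succ
            (Fin.succAbove (Fin.succ (0 : Fin (n + 1))))).submatrix
            (Fin.succAbove 0) Fin.succ) = triM (fun i => f (i + 2)) n := by
          ext i j
          simp [triM, triE_succ]
        rw [this]
        simp [triM, triE]
      · intro i _
        simp [triM, triE]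
    rw [e1, e2]
    simp [triM, triE]
    ring
  · intro i _
    simp [triM, triE]

theorem triM_fib (n : ℕ) : (triM (fun i => if i + 1 = n then 2 else 3) n).det =
    (Nat.fib (2 * n + 1) : ℤ) := by
  induction n using Nat.twoStepInduction with
  | zero => simp [triM]
  | one => simp [triM, triE]; decide
  | more n h1 h2 =>
    rw [triM_det]
    simp only [Nat.add_right_cancel_iff, show ∀ i, (i + 2 + 1 = n + 2) = (i + 1 = n) by
      intro i; simp, show ∀ i, (i + 1 + 1 = n + 2) = (i + 1 = n + 1) by
      intro i; simp] at *
    rw [h1, h2]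
    have a1 : Nat.fib (2 * (n + 2) + 1) = _ := Nat.fib_add_two (n := 2 * n + 3)
    have a2 : Nat.fib (2 * n + 4) = _ := Nat.fib_add_two (n := 2 * n + 2)
    have a3 : Nat.fib (2 * n + 3) = _ := Nat.fib_add_two (n := 2 * n + 1)
    rw [show 2 * (n + 1) + 1 = 2 * n + 3 by ring, if_neg (by omega)]
    norm_num at *
    zify at *
    linarith

/-- The diagonal of the final tridiagonal matrix. -/
def diagF (k i : ℕ) : ℤ := 3 - (if i = 0 then 1 else 0) - (if i + 1 = k then 1 else 0)

theorem triM_diagF (k : ℕ) (hk : 1 ≤ k) : (triM (diagF k) k).det = (Nat.fib (2 * k) : ℤ) := by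
  obtain _ | _ | n := k
  · omega
  · simp [triM, triE, diagF]
  · rw [triM_det]
    have e1 : (fun i => diagF (n + 2) (i + 1)) = fun i => if i + 1 = n + 1 then 2 else 3 := by
      funext i
      simp only [diagF]
      split_ifs <;> first | contradiction | omega
    have e2 : (fun i => diagF (n + 2) (i + 2)) = fun i => if i + 1 = n then 2 else 3 := by
      funext i
      simp only [diagF]
      split_ifs <;> first | contradiction | omega
    have e0 : diagF (n + 2) 0 = 2 := by simp [diagF]
    rw [show n + 1 + 1 = n + 2 by ring, e1, e2, e0, triM_fib, triM_fib]
    have a2 : Nat.fib (2 * (n + 2)) = _ := Nat.fib_add_two (n := 2 * n + 2)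
    have a3 : Nat.fib (2 * (n + 1) + 1) = _ := Nat.fib_add_two (n := 2 * n + 1)
    rw [show 2 * n + 2 + 1 = 2 * (n + 1) + 1 by ring] at a2
    rw [show 2 * n + 1 + 1 = 2 * n + 2 by ring] at a3
    zify at *
    linarith

theorem tri_sum (k p j : ℕ) (hp : p < k) (hj : j < k) :
    ∑ q ∈ Finset.range k, triE (diagF k) p q * ballotL j q =
      ballotL j p + ballotL (j + 1) p - if p = k - 1 ∧ j = k - 1 then 1 else 0 := by
  have hlast : (if p + 1 < k then ballotL j (p + 1) else 0) = ballotL j (p + 1) := by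
    split_ifs with h
    · rfl
    · rw [ballotL_eq_zero (by omega)]
  have hc : (if p + 1 = k then ballotL j p else 0) =
      if p = k - 1 ∧ j = k - 1 then 1 else 0 := by
    by_cases h : p + 1 = k
    · by_cases h' : j = p
      · subst h'
        rw [if_pos h, if_pos (by omega), ballotL_self]
      · rw [if_pos h, if_neg (by omega), ballotL_eq_zero (by omega)]
    · rw [if_neg h, if_neg (by omega)]
  rw [← hc]
  simp only [triE, add_mul, Finset.sum_add_distrib, ite_mul, zero_mul, one_mul,
    Finset.sum_ite_eq, Finset.mem_range, hlast, if_pos hp]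
  cases p with
  | zero =>
    rw [ballotL_succ_zero]
    simp [diagF]
    split_ifs <;> ring
  | succ p =>
    simp only [Nat.add_right_cancel_iff, Finset.sum_ite_eq, Finset.mem_range,
      if_pos (show p < k by omega)]
    rw [ballotL_succ_succ]
    simp [diagF]
    split_ifs <;> ring

/-- For every `k ≥ 1`, `det (H_k(C) + H'_k(C) - E_{k-1,k-1}) = F_{2k}`, where `C` is the
Catalan sequence: the `(i,j)` entry of the matrix is `catalan (i+j) + catalan (i+j+1)`,
minus `1` when `i = j = k - 1`. -/
theorem det_catalan_hankel_sum_sub_corner_eq_fib (k : ℕ) (hk : 1 ≤ k) :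
    (Matrix.of fun i j : Fin k =>
      (catalan ((i : ℕ) + (j : ℕ)) : ℤ) + (catalan ((i : ℕ) + (j : ℕ) + 1) : ℤ)
        - (if (i : ℕ) = k - 1 ∧ (j : ℕ) = k - 1 then 1 else 0)).det
      = (Nat.fib (2 * k) : ℤ) := by
  set B : Matrix (Fin k) (Fin k) ℤ := Matrix.of fun i j => ballotL i j with hB
  have hdet : B.det = 1 := by
    rw [Matrix.det_of_isLowerTriangular]
    · simp [hB, ballotL_self]
    · intro i j hij
      exact ballotL_eq_zero (by simpa using hij)
  have key : (Matrix.of fun i j : Fin k =>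
      (catalan ((i : ℕ) + (j : ℕ)) : ℤ) + (catalan ((i : ℕ) + (j : ℕ) + 1) : ℤ)
        - (if (i : ℕ) = k - 1 ∧ (j : ℕ) = k - 1 then 1 else 0)) =
      B * (triM (diagF k) k * B.transpose) := by
    ext i j
    have h1 : ∀ p : Fin k, (triM (diagF k) k * B.transpose) p j =
        ballotL j p + ballotL (j + 1) p
          - if (p : ℕ) = k - 1 ∧ (j : ℕ) = k - 1 then 1 else 0 := by
      intro p
      rw [← tri_sum k p j p.2 j.2, Matrix.mul_apply,
        ← Fin.sum_univ_eq_sum_range (fun q => triE (diagF k) p q * ballotL j q)]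
      rfl
    have h2 : ∀ p : Fin k, B i p = ballotL i p := fun _ => rfl
    rw [Matrix.mul_apply]
    simp only [h1, h2, Matrix.of_apply, mul_sub, mul_add, Finset.sum_sub_distrib,
      Finset.sum_add_distrib]
    rw [Fin.sum_univ_eq_sum_range (fun p => ballotL i p * ballotL j p),
      Fin.sum_univ_eq_sum_range (fun p => ballotL i p * ballotL (j + 1) p),
      Fin.sum_univ_eq_sum_range (fun p => ballotL i p *
        if p = k - 1 ∧ (j : ℕ) = k - 1 then 1 else 0),
      ballotL_sum _ _ _ i.2, ballotL_sum _ _ _ i.2, ballotL_zero_right, ballotL_zero_right,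
      ← add_assoc]
    congr 1
    have hi := i.2
    rw [Finset.sum_eq_single (k - 1)]
    · by_cases h : (i : ℕ) = k - 1
      · rw [h, ballotL_self]
        simp
      · rw [ballotL_eq_zero (by omega), if_neg (by omega)]
        simp
    · intro b _ hb
      simp [hb]
    · intro h
      simp at h
      omega
  rw [key, Matrix.det_mul, Matrix.det_mul, Matrix.det_transpose, hdet, triM_diagF k hk]
  simp
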